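/- Let Φ be a recurrent CH system on V with parameter array ({θ_i}_{i=0}^d, {θ*_i}_{i=0}^d, {φ_i}_{i=1}^d). Fix nonzero vectors u* ∈ E*_0V and u ∈ E_0V. Let ξ* denote the (0,d)-entry of the matrix representing A* with respect to the basis {E_i u*}_{i=0}^d, and let ξ denote the (0,d)-entry of the matrix representing A with respect to the basis {E*_i u}_{i=0}^d. Then ξ = (φ_1 − φ_d)/(θ*_1 − θ*_d) + [(θ_1−θ_0)(θ*_d−θ*_0) − (θ_d−θ_0)(θ*_1−θ*_0)]/(θ*_1 − θ*_d) and ξ* = (φ_d − φ_1)/(θ_1 − θ_d) + [(θ*_1−θ*_0)(θ_d−θ_0) − (θ*_d−θ*_0)(θ_1−θ_0)]/(θ_1 − θ_d). -/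

import Mathlib

open Polynomial Finset Module

variable {F V : Type*} [Field F] [AddCommGroup V] [Module F V]

/-- The primitive idempotent of `A` for the eigenvalue `θ i`, where the eigenvalues of `A`
are `θ 0, …, θ d`. -/
noncomputable def primIdem (d : ℕ) (A : Module.End F V) (θ : ℕ → F) (i : ℕ) :
    Module.End F V :=
  Polynomial.aeval A (∏ j ∈ (Finset.range (d+1)).erase i,
    (Polynomial.C (θ i - θ j)⁻¹ * (Polynomial.X - Polynomial.C (θ j))))

/-- A sequence `σ 0, …, σ n` is `β`-recurrent. -/
def BetaRecurrent (β : F) (n : ℕ) (σ : ℕ → F) : Prop :=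
  ∀ i, 2 ≤ i → i + 1 ≤ n → σ (i-2) - (β+1) * σ (i-1) + (β+1) * σ i - σ (i+1) = 0

/-- The scalars ϑ_i attached to eigenvalue data `θ, θs` and a split sequence `φ`:
`ϑ 0 = 0`, `ϑ (d+1) = 0` and `ϑ i = φ i - (θs i - θs 0)(θ (d-i+1) - θ 0)` for `1 ≤ i ≤ d`. -/
def vth (d : ℕ) (θ θs φ : ℕ → F) (i : ℕ) : F :=
  if 1 ≤ i ∧ i ≤ d then φ i - (θs i - θs 0) * (θ (d - i + 1) - θ 0) else 0

/-- `φ 1, …, φ d` is the split sequence for `(A, As)` with eigenvalue data `θ, θs`: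
there is a (split) basis `v 0, …, v d` of `V` on which `A, As` act in the prescribed way. -/
def SplitSeq (d : ℕ) (A As : Module.End F V) (θ θs φ : ℕ → F) : Prop :=
  ∃ v : ℕ → V,
    LinearIndependent F (fun i : Fin (d+1) => v i) ∧
    Submodule.span F (v '' Set.Iic d) = ⊤ ∧
    (∀ i < d, A (v i) = θ (d - i) • v i + v (i+1)) ∧
    A (v d) = θ 0 • v d ∧
    As (v 0) = θs 0 • v 0 ∧
    (∀ i, 1 ≤ i → i ≤ d → As (v i) = θs i • v i + φ i • v (i-1))

/-- A circular Hessenberg system on `V` of diameter `d`. -/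
structure CHSystem (F V : Type*) [Field F] [AddCommGroup V] [Module F V] (d : ℕ) where
  A : Module.End F V
  As : Module.End F V
  θ : ℕ → F
  θs : ℕ → F
  θ_inj : ∀ i ≤ d, ∀ j ≤ d, θ i = θ j → i = j
  θs_inj : ∀ i ≤ d, ∀ j ≤ d, θs i = θs j → i = j
  A_ann : Polynomial.aeval A (∏ j ∈ Finset.range (d+1), (Polynomial.X - Polynomial.C (θ j))) = 0
  As_ann : Polynomial.aeval As (∏ j ∈ Finset.range (d+1), (Polynomial.X - Polynomial.C (θs j))) = 0
  A_eig : ∀ i ≤ d, Module.End.HasEigenvalue A (θ i)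
  As_eig : ∀ i ≤ d, Module.End.HasEigenvalue As (θs i)
  circ₁ : ∀ i ≤ d, ∀ j ≤ d, ((j:ℤ) + 1 < (i:ℤ) ∨ (1 < (j:ℤ) - (i:ℤ) ∧ (j:ℤ) - (i:ℤ) < (d:ℤ))) →
      primIdem d A θ i * As * primIdem d A θ j = 0
  circ₂ : ∀ i ≤ d, ∀ j ≤ d, ((i:ℤ) = (j:ℤ) + 1 ∨ (j:ℤ) = (i:ℤ) + (d:ℤ)) →
      primIdem d A θ i * As * primIdem d A θ j ≠ 0
  circ₃ : ∀ i ≤ d, ∀ j ≤ d, ((j:ℤ) + 1 < (i:ℤ) ∨ (1 < (j:ℤ) - (i:ℤ) ∧ (j:ℤ) - (i:ℤ) < (d:ℤ))) →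
      primIdem d As θs i * A * primIdem d As θs j = 0
  circ₄ : ∀ i ≤ d, ∀ j ≤ d, ((i:ℤ) = (j:ℤ) + 1 ∨ (j:ℤ) = (i:ℤ) + (d:ℤ)) →
      primIdem d As θs i * A * primIdem d As θs j ≠ 0

section PrimitiveIdempotent

variable {d : ℕ} {X : Module.End F V} {α : ℕ → F}

theorem primIdem_eq_aeval_basis (d : ℕ) (X : Module.End F V) (α : ℕ → F) (i : ℕ) :
    primIdem d X α i = aeval X (Lagrange.basis (range (d + 1)) α i) :=
  rfl

theorem sum_primIdem (hα : ∀ i ≤ d, ∀ j ≤ d, α i = α j → i = j) :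
    ∑ i ∈ range (d + 1), primIdem d X α i = 1 := by
  simp only [primIdem_eq_aeval_basis]
  rw [← map_sum, Lagrange.sum_basis _ ⟨0, by simp⟩, map_one]
  intro i hi j hj h
  simp only [coe_range, Set.mem_Iio] at hi hj
  exact hα i (by omega) j (by omega) h

theorem sum_primIdem_apply (hα : ∀ i ≤ d, ∀ j ≤ d, α i = α j → i = j) (x : V) :
    ∑ i ∈ range (d + 1), primIdem d X α i x = x := by
  simpa using congrArg (fun T : Module.End F V => T x) (sum_primIdem (X := X) hα)

theorem primIdem_mul_self_sub
    (hX : aeval X (∏ j ∈ range (d + 1), (Polynomial.X - C (α j))) = 0)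
    {i : ℕ} (hi : i ≤ d) : aeval X (Polynomial.X - C (α i)) * primIdem d X α i = 0 := by
  have hmem : i ∈ range (d + 1) := by simpa using Nat.lt_succ_of_le hi
  rw [primIdem, ← map_mul, prod_mul_distrib, mul_left_comm, mul_prod_erase _ (fun j => Polynomial.X - C (α j)) hmem,
    map_mul, hX, mul_zero]

theorem apply_primIdem
    (hX : aeval X (∏ j ∈ range (d + 1), (Polynomial.X - C (α j))) = 0)
    {i : ℕ} (hi : i ≤ d) (x : V) :
    X (primIdem d X α i x) = α i • primIdem d X α i x := by
  have h := congrArg (fun T : Module.End F V => T x) (primIdem_mul_self_sub hX hi)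
  simpa [sub_eq_zero, Module.algebraMap_end_apply] using h

theorem primIdem_apply_comm (i : ℕ) (x : V) :
    primIdem d X α i (X x) = X (primIdem d X α i x) := by
  have h := congrArg (aeval X) (mul_comm (Lagrange.basis (range (d + 1)) α i) Polynomial.X)
  rw [map_mul, map_mul, aeval_X, ← primIdem_eq_aeval_basis] at h
  exact congrArg (fun T : Module.End F V => T x) h

theorem primIdem_apply
    (hX : aeval X (∏ j ∈ range (d + 1), (Polynomial.X - C (α j))) = 0)
    {i : ℕ} (hi : i ≤ d) (x : V) :
    primIdem d X α i (X x) = α i • primIdem d X α i x := by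
  rw [primIdem_apply_comm, apply_primIdem hX hi]

theorem primIdem_primIdem_of_ne (hα : ∀ i ≤ d, ∀ j ≤ d, α i = α j → i = j)
    (hX : aeval X (∏ j ∈ range (d + 1), (Polynomial.X - C (α j))) = 0)
    {i j : ℕ} (hi : i ≤ d) (hj : j ≤ d) (hij : i ≠ j) (x : V) :
    primIdem d X α i (primIdem d X α j x) = 0 := by
  have h := primIdem_apply hX hi (primIdem d X α j x)
  rw [apply_primIdem hX hj, map_smul, ← sub_eq_zero, ← sub_smul, smul_eq_zero, sub_eq_zero] at h
  exact h.resolve_left fun h => hij (hα j hj i hi h).symm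

theorem primIdem_apply_of_eigen (hα : ∀ i ≤ d, ∀ j ≤ d, α i = α j → i = j)
    (hX : aeval X (∏ j ∈ range (d + 1), (Polynomial.X - C (α j))) = 0)
    {i : ℕ} (hi : i ≤ d) {x : V} (hx : X x = α i • x) : primIdem d X α i x = x := by
  have h0 : ∀ j ∈ range (d + 1), j ≠ i → primIdem d X α j x = 0 := by
    intro j hj hji
    have hj : j ≤ d := by simpa [Nat.lt_succ_iff] using hj
    have h := primIdem_apply hX hj x
    rw [hx, map_smul, ← sub_eq_zero, ← sub_smul, smul_eq_zero, sub_eq_zero] at h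
    exact h.resolve_left fun h => hji (hα i hi j hj h).symm
  have h := sum_primIdem_apply (X := X) hα x
  rwa [sum_eq_single_of_mem i (by simpa using Nat.lt_succ_of_le hi) h0] at h

theorem primIdem_primIdem (hα : ∀ i ≤ d, ∀ j ≤ d, α i = α j → i = j)
    (hX : aeval X (∏ j ∈ range (d + 1), (Polynomial.X - C (α j))) = 0)
    {i : ℕ} (hi : i ≤ d) (x : V) :
    primIdem d X α i (primIdem d X α i x) = primIdem d X α i x :=
  primIdem_apply_of_eigen hα hX hi (apply_primIdem hX hi x)

end PrimitiveIdempotent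

section SplitBasis

variable {d : ℕ} {X Y : Module.End F V} {α β c e : ℕ → F} {v : ℕ → V}

theorem primIdem_zero_mem_span_of_raising (hβ : ∀ i ≤ d, ∀ j ≤ d, β i = β j → i = j)
    (hYann : aeval Y (∏ j ∈ range (d + 1), (Polynomial.X - C (β j))) = 0)
    (hspan : Submodule.span F (v '' Set.Iic d) = ⊤)
    (hY0 : Y (v 0) = β 0 • v 0)
    (hY : ∀ i < d, Y (v (i + 1)) = β (i + 1) • v (i + 1) + e i • v i) (x : V) :
    primIdem d Y β 0 x ∈ Submodule.span F {v 0} := by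
  have key : ∀ i ≤ d, primIdem d Y β 0 (v i) ∈ Submodule.span F {v 0} := by
    intro i
    induction i with
    | zero =>
      intro _
      rw [primIdem_apply_of_eigen hβ hYann (Nat.zero_le d) hY0]
      exact Submodule.mem_span_singleton_self _
    | succ i ih =>
      intro hi
      have h := primIdem_apply hYann (Nat.zero_le d) (v (i + 1))
      rw [hY i hi, map_add, map_smul, map_smul] at h
      have hne : β 0 - β (i + 1) ≠ 0 := fun h0 => by
        have := hβ 0 (Nat.zero_le d) (i + 1) hi (sub_eq_zero.mp h0)
        omega
      rw [← Submodule.smul_mem_iff _ hne, sub_smul, ← h, add_sub_cancel_left]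
      exact Submodule.smul_mem _ _ (ih (by omega))
  have hle : Submodule.span F (v '' Set.Iic d) ≤
      (Submodule.span F {v 0}).comap (primIdem d Y β 0) := by
    rw [Submodule.span_le]
    rintro _ ⟨i, hi, rfl⟩
    exact key i hi
  exact hle (hspan ▸ Submodule.mem_top)

theorem smul_primIdem_zero_succ
    (hXann : aeval X (∏ j ∈ range (d + 1), (Polynomial.X - C (α j))) = 0)
    (hX : ∀ i < d, X (v i) = α (d - i) • v i + c i • v (i + 1)) {i : ℕ} (hi : i < d) :
    c i • primIdem d X α 0 (v (i + 1)) = (α 0 - α (d - i)) • primIdem d X α 0 (v i) := by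
  have h := primIdem_apply hXann (Nat.zero_le d) (v i)
  rw [hX i hi, map_add, map_smul, map_smul] at h
  rw [sub_smul, ← h, add_sub_cancel_left]

theorem exists_primIdem_zero_eq_smul
    (hXann : aeval X (∏ j ∈ range (d + 1), (Polynomial.X - C (α j))) = 0)
    (hc : ∀ i < d, c i ≠ 0)
    (hX : ∀ i < d, X (v i) = α (d - i) • v i + c i • v (i + 1)) {i : ℕ} (hi : i ≤ d) :
    ∃ k : F, primIdem d X α 0 (v i) = k • primIdem d X α 0 (v 0) := by
  induction i with
  | zero => exact ⟨1, (one_smul _ _).symm⟩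
  | succ i ih =>
    obtain ⟨k, hk⟩ := ih (by omega)
    have h := smul_primIdem_zero_succ hXann hX hi
    refine ⟨(c i)⁻¹ * ((α 0 - α (d - i)) * k), ?_⟩
    rw [mul_smul, mul_smul, ← hk, ← h, inv_smul_smul₀ (hc i hi)]

/-- The corner entry of the matrix representing `Y` with respect to the eigenbasis of `X`
obtained by projecting an eigenvector of `Y`. -/
theorem corner_entry_mul (hd : 2 ≤ d)
    (hα : ∀ i ≤ d, ∀ j ≤ d, α i = α j → i = j)
    (hβ : ∀ i ≤ d, ∀ j ≤ d, β i = β j → i = j)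
    (hXann : aeval X (∏ j ∈ range (d + 1), (Polynomial.X - C (α j))) = 0)
    (hYann : aeval Y (∏ j ∈ range (d + 1), (Polynomial.X - C (β j))) = 0)
    (hcirc : ∀ j, 1 < j → j < d → primIdem d X α 0 * Y * primIdem d X α j = 0)
    (hvd : v d ≠ 0) (hspan : Submodule.span F (v '' Set.Iic d) = ⊤)
    (hc : ∀ i < d, c i ≠ 0)
    (hX : ∀ i < d, X (v i) = α (d - i) • v i + c i • v (i + 1))
    (hXd : X (v d) = α 0 • v d)
    (hY0 : Y (v 0) = β 0 • v 0)
    (hY : ∀ i < d, Y (v (i + 1)) = β (i + 1) • v (i + 1) + e i • v i)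
    {u : V} (hu0 : u ≠ 0) (hu : u ∈ LinearMap.range (primIdem d Y β 0)) {m : ℕ → F}
    (hm : Y (primIdem d X α d u) = ∑ i ∈ range (d + 1), m i • primIdem d X α i u) :
    m 0 * (α 1 - α d) = c (d - 1) * e (d - 1) - c 0 * e 0 + (β 1 - β 0) * (α d - α 0)
      - (β d - β 0) * (α 1 - α 0) := by
  set E := primIdem d X α with hE
  have hEd : E 0 (v d) = v d := primIdem_apply_of_eigen hα hXann (Nat.zero_le d) hXd
  obtain ⟨k, hk⟩ := exists_primIdem_zero_eq_smul hXann hc hX le_rfl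
  rw [← hE, hEd] at hk
  have hk0 : k ≠ 0 := by
    rintro rfl
    exact hvd (by rw [hk, zero_smul])
  have hw0 : E 0 (v 0) ≠ 0 := by
    intro h
    exact hvd (by rw [hk, h, smul_zero])
  -- the coefficient extracted from the corner
  have hcorner : E 0 (Y (E d (v 0))) = m 0 • E 0 (v 0) := by
    obtain ⟨y, rfl⟩ := hu
    obtain ⟨a, ha⟩ := Submodule.mem_span_singleton.mp
      (primIdem_zero_mem_span_of_raising hβ hYann hspan hY0 hY y)
    rw [← ha] at hm hu0
    have ha0 : a ≠ 0 := by
      rintro rfl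
      exact hu0 (zero_smul _ _)
    have h := congrArg (E 0) hm
    rw [map_sum, sum_eq_single_of_mem 0 (by simp)] at h
    · rw [map_smul (E 0) (m 0), map_smul (E 0) a, map_smul (E 0) a,
        primIdem_primIdem hα hXann (Nat.zero_le d), map_smul (E d), map_smul Y, map_smul (E 0),
        smul_comm] at h
      exact smul_right_injective V ha0 h
    · intro j hj hj0
      rw [map_smul, primIdem_primIdem_of_ne hα hXann (Nat.zero_le d)
        (by simpa [Nat.lt_succ_iff] using hj) hj0.symm, smul_zero]
  -- three-term reduction of sums
  have hred : ∀ f : ℕ → F, ∑ j ∈ range (d + 1), f j • E 0 (Y (E j (v 0)))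
      = f 0 • E 0 (Y (E 0 (v 0))) + f 1 • E 0 (Y (E 1 (v 0))) + f d • E 0 (Y (E d (v 0))) := by
    intro f
    have hsub : ({0, 1, d} : Finset ℕ) ⊆ range (d + 1) := by
      intro j hj
      simp only [mem_insert, mem_singleton] at hj
      simp only [mem_range]
      omega
    rw [← sum_subset hsub]
    · rw [sum_insert (by simp; omega), sum_insert (by simp; omega), sum_singleton, add_assoc]
    · intro j hj hj'
      simp only [mem_insert, mem_singleton, mem_range] at hj hj'
      have h := congrArg (fun T : Module.End F V => T (v 0)) (hcirc j (by omega) (by omega))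
      have h' : E 0 (Y (E j (v 0))) = 0 := h
      rw [h', smul_zero]
  have h1 : E 0 (Y (E 0 (v 0))) + E 0 (Y (E 1 (v 0))) + E 0 (Y (E d (v 0)))
      = β 0 • E 0 (v 0) := by
    have h := hred fun _ => 1
    simp only [one_smul] at h
    rw [← h, ← map_sum, ← map_sum, sum_primIdem_apply hα, hY0, map_smul]
  have h2 : (α 0 - α d) • E 0 (Y (E 0 (v 0))) + (α 1 - α d) • E 0 (Y (E 1 (v 0)))
      = (β 1 * (α 0 - α d) + c 0 * e 0) • E 0 (v 0) := by
    have h := hred fun j => α j - α d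
    simp only [sub_self, zero_smul, add_zero] at h
    have hsum : ∑ j ∈ range (d + 1), (α j - α d) • E j (v 0) = c 0 • v 1 := by
      have hx := hX 0 (by omega)
      rw [Nat.sub_zero, zero_add] at hx
      rw [← sub_eq_iff_eq_add'] at hx
      rw [← hx]
      conv_rhs => rw [← sum_primIdem_apply (X := X) hα (v 0)]
      rw [map_sum, smul_sum, ← sum_sub_distrib]
      refine sum_congr rfl fun j hj => ?_
      rw [apply_primIdem hXann (by simpa [Nat.lt_succ_iff] using hj), sub_smul]
    have hs := smul_primIdem_zero_succ hXann hX (i := 0) (by omega)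
    rw [Nat.sub_zero, zero_add] at hs
    have hy := hY 0 (by omega)
    rw [zero_add] at hy
    have hsum' := congrArg (fun x => E 0 (Y x)) hsum
    simp only [map_sum, map_smul] at hsum'
    rw [← h, hsum', hy, map_add, map_smul, map_smul, smul_add, smul_comm, hs]
    module
  have h3 : (α 0 - α 1) • E 0 (Y (E 0 (v 0)))
      = ((α 0 - α 1) * β d + c (d - 1) * e (d - 1)) • E 0 (v 0) := by
    have hs := smul_primIdem_zero_succ hXann hX (i := d - 1) (by omega)
    have hy := hY (d - 1) (by omega)
    rw [show d - 1 + 1 = d by omega] at hs hy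
    rw [show d - (d - 1) = 1 by omega, ← hE, hEd] at hs
    have hd' : (α 0 - α 1) • E 0 (Y (v d))
        = ((α 0 - α 1) * β d + c (d - 1) * e (d - 1)) • v d := by
      rw [hy, map_add, map_smul, map_smul, hEd, smul_add, smul_comm _ (e (d - 1)), ← hs]
      module
    rw [hk] at hd'
    rw [map_smul, map_smul, smul_comm _ k, smul_comm _ k] at hd'
    exact smul_right_injective V hk0 hd'
  rw [hcorner] at h1
  have hfin : (m 0 * (α 1 - α d) - (c (d - 1) * e (d - 1) - c 0 * e 0
      + (β 1 - β 0) * (α d - α 0) - (β d - β 0) * (α 1 - α 0))) • E 0 (v 0) = 0 := by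
    linear_combination (norm := module) (α 1 - α d) • h1 - h2 + h3
  exact sub_eq_zero.mp ((smul_eq_zero.mp hfin).resolve_right hw0)

end SplitBasis

/-- formulas for the corner entries `ξ` and `ξ*` in terms of the
parameter array. -/
theorem stmt17 {F V : Type*} [Field F] [AddCommGroup V] [Module F V]
    (d : ℕ) (hd : 3 ≤ d) (hdim : Module.finrank F V = d + 1)
    (Φ : CHSystem F V d) (φ : ℕ → F)
    (hφ0 : ∀ i, 1 ≤ i → i ≤ d → φ i ≠ 0)
    (hsplit : SplitSeq d Φ.A Φ.As Φ.θ Φ.θs φ)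
    (hrec : ∃ β : F, BetaRecurrent β d Φ.θ ∧ BetaRecurrent β d Φ.θs ∧
      BetaRecurrent β (d+1) (vth d Φ.θ Φ.θs φ))
    (ustar u : V) (hustar0 : ustar ≠ 0) (hu0 : u ≠ 0)
    (hustar : ustar ∈ LinearMap.range (primIdem d Φ.As Φ.θs 0))
    (hu : u ∈ LinearMap.range (primIdem d Φ.A Φ.θ 0))
    -- `Bs` is the matrix representing `A*` in the `Φ`-standard basis `{E i ustar}`
    (Bs : ℕ → ℕ → F)
    (hBs : ∀ j ≤ d, Φ.As (primIdem d Φ.A Φ.θ j ustar)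
      = ∑ i ∈ Finset.range (d+1), Bs i j • primIdem d Φ.A Φ.θ i ustar)
    -- `B` is the matrix representing `A` in the `Φ*`-standard basis `{E* i u}`
    (B : ℕ → ℕ → F)
    (hB : ∀ j ≤ d, Φ.A (primIdem d Φ.As Φ.θs j u)
      = ∑ i ∈ Finset.range (d+1), B i j • primIdem d Φ.As Φ.θs i u)
    (ξ ξs : F) (hξ : ξ = B 0 d) (hξs : ξs = Bs 0 d) :
    ξ = (φ 1 - φ d) / (Φ.θs 1 - Φ.θs d)
        + ((Φ.θ 1 - Φ.θ 0) * (Φ.θs d - Φ.θs 0)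
            - (Φ.θ d - Φ.θ 0) * (Φ.θs 1 - Φ.θs 0)) / (Φ.θs 1 - Φ.θs d) ∧
    ξs = (φ d - φ 1) / (Φ.θ 1 - Φ.θ d)
        + ((Φ.θs 1 - Φ.θs 0) * (Φ.θ d - Φ.θ 0)
            - (Φ.θs d - Φ.θs 0) * (Φ.θ 1 - Φ.θ 0)) / (Φ.θ 1 - Φ.θ d) := by
  obtain ⟨v, hli, hspan, hA, hAd, hAs0, hAs⟩ := hsplit
  have hv : ∀ i ≤ d, v i ≠ 0 := fun i hi => hli.ne_zero (⟨i, by omega⟩ : Fin (d + 1))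
  constructor
  · have hspan' : Submodule.span F ((fun i => v (d - i)) '' Set.Iic d) = ⊤ := by
      rw [eq_top_iff, ← hspan]
      refine Submodule.span_mono ?_
      rintro _ ⟨i, hi, rfl⟩
      exact ⟨d - i, Nat.sub_le d i, congrArg v (Nat.sub_sub_self hi)⟩
    have h := corner_entry_mul (v := fun i => v (d - i)) (c := fun i => φ (d - i))
      (e := fun _ => 1) (by omega) Φ.θs_inj Φ.θ_inj Φ.As_ann Φ.A_ann
      (fun j h1 h2 => Φ.circ₃ 0 (by omega) j (by omega) (by omega))
      (hv _ (by omega)) hspan' (fun i hi => hφ0 _ (by omega) (by omega))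
      (fun i hi => hAs _ (by omega) (by omega)) (by simpa using hAs0) (by simpa using hAd)
      (fun i hi => by
        have h := hA (d - (i + 1)) (by omega)
        rwa [show d - (d - (i + 1)) = i + 1 by omega, show d - (i + 1) + 1 = d - i by omega,
          ← one_smul F (v (d - i))] at h)
      hu0 hu (hB d le_rfl)
    have hne : Φ.θs 1 - Φ.θs d ≠ 0 := fun h0 => by
      have := Φ.θs_inj 1 (by omega) d le_rfl (sub_eq_zero.mp h0)
      omega
    rw [hξ, ← add_div, eq_div_iff hne, h, show d - (d - 1) = 1 by omega, Nat.sub_zero]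
    ring
  · have h := corner_entry_mul (c := fun _ => 1) (e := fun i => φ (i + 1)) (by omega)
      Φ.θ_inj Φ.θs_inj Φ.A_ann Φ.As_ann
      (fun j h1 h2 => Φ.circ₁ 0 (by omega) j (by omega) (by omega))
      (hv d le_rfl) hspan (fun _ _ => one_ne_zero)
      (fun i hi => by rw [one_smul, hA i hi]) hAd hAs0
      (fun i hi => hAs (i + 1) (by omega) hi) hustar0 hustar (hBs d le_rfl)
    have hne : Φ.θ 1 - Φ.θ d ≠ 0 := fun h0 => by
      have := Φ.θ_inj 1 (by omega) d le_rfl (sub_eq_zero.mp h0)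
      omega
    rw [hξs, ← add_div, eq_div_iff hne, h, show d - 1 + 1 = d by omega, zero_add]
    ring
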